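/- Let d ≥ 1 and let ℓ : [0,∞) → [0,∞) satisfy (A1,i): ℓ(0) = 0 and ℓ(ru) ≥ rℓ(u) for all r ∈ (0,1), u > 0; (A1,iii): ℓ(u) > 0 for u > 0; and (A2,i): ℓ is non-decreasing. Then for any Borel probability measures P₀, P₁ on ℝ^d, Ṽ₁(P₀,P₁) = Ṽ₂(P₀,P₁). -/

import Mathlib

open MeasureTheory Set Filter
open scoped ENNReal NNReal Classical

noncomputable section

/-- `ℝ^d` with the Euclidean norm. -/
abbrev Vec (d : ℕ) := EuclideanSpace ℝ (Fin d)

/-- essential supremum of `|φ|` on `[0,t]` (`‖φ‖_{∞,t}`), as an extended nonnegative real. -/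
def eSupT {d : ℕ} (φ : ℝ → Vec d) (t : ℝ) : ℝ≥0∞ :=
  essSup (fun s => (‖φ s‖₊ : ℝ≥0∞)) (volume.restrict (Icc (0:ℝ) t))

/-- `‖φ‖_∞` on `[0,1]`. -/
def eSup01 {d : ℕ} (φ : ℝ → Vec d) : ℝ≥0∞ := eSupT φ 1

/-- `N₁(φ)_t`. -/
def N1T {d : ℕ} (φ : ℝ → Vec d) (t : ℝ) : ℝ :=
  if (∫ s in (0:ℝ)..t, φ s) ≠ 0 then t * (eSupT φ t).toReal / ‖∫ s in (0:ℝ)..t, φ s‖ else 1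

/-- `N₂(φ)_t`. -/
def N2T {d : ℕ} (φ : ℝ → Vec d) (t : ℝ) : ℝ :=
  if 0 < (∫ s in (0:ℝ)..t, ‖φ s‖) then t * (eSupT φ t).toReal / (∫ s in (0:ℝ)..t, ‖φ s‖) else 1

/-- `N₁(φ) = N₁(φ)₁`. -/
def N1 {d : ℕ} (φ : ℝ → Vec d) : ℝ := N1T φ 1

/-- `N₂(φ) = N₂(φ)₁`. -/
def N2 {d : ℕ} (φ : ℝ → Vec d) : ℝ := N2T φ 1

/-- the position at time `t` of the absolutely continuous path starting at `ξ`
with velocity `φ`. -/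
def pathAt {d : ℕ} (ξ : Vec d) (φ : ℝ → Vec d) (t : ℝ) : Vec d := ξ + ∫ s in (0:ℝ)..t, φ s

/-- the endpoint `X(1)` of the path starting at `ξ` with velocity `φ`. -/
def endPt {d : ℕ} (ξ : Vec d) (φ : ℝ → Vec d) : Vec d := ξ + ∫ s in (0:ℝ)..1, φ s

/-- The Monge–Kantorovich cost `T(P₀,P₁) = inf E[L(X₁ - X₀)]`, the infimum being over
pairs of random variables, on some probability space, with laws `P₀` and `P₁`. -/
def MKcost {d : ℕ} (L : Vec d → ℝ) (P₀ P₁ : Measure (Vec d)) : ℝ≥0∞ :=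
  sInf { c | ∃ (Ω : Type) (_ : MeasureSpace Ω), IsProbabilityMeasure (volume : Measure Ω) ∧
    ∃ (X₀ X₁ : Ω → Vec d), Measurable X₀ ∧ Measurable X₁ ∧
      Measure.map X₀ volume = P₀ ∧ Measure.map X₁ volume = P₁ ∧
      c = ∫⁻ ω, ENNReal.ofReal (L (X₁ ω - X₀ ω)) }

/-- `(X₀, X₁)` is a minimizer of `T(P₀,P₁)`. -/
def IsTMin {d : ℕ} (L : Vec d → ℝ) (P₀ P₁ : Measure (Vec d)) (Ω : Type) [MeasureSpace Ω]
    (X₀ X₁ : Ω → Vec d) : Prop :=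
  IsProbabilityMeasure (volume : Measure Ω) ∧ Measurable X₀ ∧ Measurable X₁ ∧
  Measure.map X₀ volume = P₀ ∧ Measure.map X₁ volume = P₁ ∧
  (∫⁻ ω, ENNReal.ofReal (L (X₁ ω - X₀ ω))) = MKcost L P₀ P₁

/-- The stochastic process determined by the (measurable) initial point `ξ` and velocity
process `φ`, namely `X(ω,t) = ξ ω + ∫₀ᵗ φ(ω,s) ds`, is a member of `𝒜_∞(P₀,P₁)`:
its paths are a.s. absolutely continuous with essentially bounded derivative and
`X(0), X(1)` have laws `P₀, P₁`. -/
def IsAdmissible {d : ℕ} (P₀ P₁ : Measure (Vec d)) (Ω : Type) [MeasureSpace Ω]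
    (ξ : Ω → Vec d) (φ : Ω → ℝ → Vec d) : Prop :=
  IsProbabilityMeasure (volume : Measure Ω) ∧ Measurable ξ ∧ Measurable (Function.uncurry φ) ∧
  (∀ᵐ ω ∂(volume : Measure Ω), eSup01 (φ ω) < ⊤) ∧
  Measure.map ξ volume = P₀ ∧ Measure.map (fun ω => endPt (ξ ω) (φ ω)) volume = P₁

/-- `∫₀¹ Lᵢ(t, φ) dt` where `Lᵢ(t,φ) = Nᵢ(φ) ℓ(|φ(t)|/Nᵢ(φ))`; `N` is `N₁` or `N₂`. -/
def pathCost {d : ℕ} (ℓ : ℝ → ℝ) (N : (ℝ → Vec d) → ℝ) (φ : ℝ → Vec d) : ℝ≥0∞ :=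
  ∫⁻ t in Icc (0:ℝ) 1, ENNReal.ofReal (N φ * ℓ (‖φ t‖ / N φ))

/-- The modified Lagrangian cost `Ṽᵢ(P₀,P₁)`; take `N := N₁` resp. `N := N₂`. -/
def Vtilde {d : ℕ} (ℓ : ℝ → ℝ) (N : (ℝ → Vec d) → ℝ) (P₀ P₁ : Measure (Vec d)) : ℝ≥0∞ :=
  sInf { c | ∃ (Ω : Type) (_ : MeasureSpace Ω) (ξ : Ω → Vec d) (φ : Ω → ℝ → Vec d),
    IsAdmissible P₀ P₁ Ω ξ φ ∧ c = ∫⁻ ω, pathCost ℓ N (φ ω) }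

/-- `X(·)` (given by start `ξ` and velocity `φ`) is a minimizer of `Ṽᵢ(P₀,P₁)`. -/
def IsVtildeMin {d : ℕ} (ℓ : ℝ → ℝ) (N : (ℝ → Vec d) → ℝ) (P₀ P₁ : Measure (Vec d))
    (Ω : Type) [MeasureSpace Ω] (ξ : Ω → Vec d) (φ : Ω → ℝ → Vec d) : Prop :=
  IsAdmissible P₀ P₁ Ω ξ φ ∧ (∫⁻ ω, pathCost ℓ N (φ ω)) = Vtilde ℓ N P₀ P₁

/-- `X(t;x,y,A) = x + (|A∩[0,t]|/|A|)(y-x)` if `x ≠ y` and `|A| > 0`, else `x`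
(for `A ⊆ [0,1]`). -/
def XPath {d : ℕ} (x y : Vec d) (A : Set ℝ) (t : ℝ) : Vec d :=
  if x ≠ y ∧ 0 < volume A then
    x + (((volume (A ∩ Icc (0:ℝ) t)).toReal) / ((volume A).toReal)) • (y - x)
  else x

/-- the velocity (a.e. derivative) of `t ↦ X(t;x,y,A)` (for `A ⊆ [0,1]`). -/
def XVel {d : ℕ} (x y : Vec d) (A : Set ℝ) (s : ℝ) : Vec d :=
  if x ≠ y ∧ 0 < volume A then
    (if s ∈ A then ((volume A).toReal)⁻¹ • (y - x) else 0)
  else 0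

/-- `A : Ω → Set ℝ` is a random measurable subset of `[0,1]`. -/
def IsRandomSet (Ω : Type) [MeasureSpace Ω] (A : Ω → Set ℝ) : Prop :=
  (∀ ω, A ω ⊆ Icc (0:ℝ) 1) ∧ MeasurableSet {p : Ω × ℝ | p.2 ∈ A p.1}

/-- `V(P₀,P₁;B)`: the value of the stochastic optimal transport over pairs `(X,M)` with
`X ∈ 𝒜_∞(P₀,P₁)`, `M` a nonnegative random variable with law in `B` and `‖X'‖_∞ ≤ M` a.s. -/
def Vval {d : ℕ} (ℓ : ℝ → ℝ) (P₀ P₁ : Measure (Vec d)) (B : Set (Measure ℝ)) : ℝ≥0∞ :=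
  sInf { c | ∃ (Ω : Type) (_ : MeasureSpace Ω), IsProbabilityMeasure (volume : Measure Ω) ∧
    ∃ (ξ : Ω → Vec d) (φ : Ω → ℝ → Vec d) (M : Ω → ℝ),
      Measurable ξ ∧ Measurable (Function.uncurry φ) ∧ Measurable M ∧
      (∀ᵐ ω ∂(volume : Measure Ω), 0 ≤ M ω) ∧ Measure.map M volume ∈ B ∧
      (∀ᵐ ω ∂(volume : Measure Ω), eSup01 (φ ω) ≤ ENNReal.ofReal (M ω)) ∧
      Measure.map ξ volume = P₀ ∧ Measure.map (fun ω => endPt (ξ ω) (φ ω)) volume = P₁ ∧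
      c = ∫⁻ ω, ∫⁻ t in Icc (0:ℝ) 1, ENNReal.ofReal (ℓ ‖φ ω t‖) }

/-- `T^V(P₀,P₁;B) = inf E[ℓ(M) M⁻¹ |X₁-X₀| ; M > 0]` over `(X₀,X₁,M) ∈ Π_∞(P₀,P₁;B)`. -/
def TVval {d : ℕ} (ℓ : ℝ → ℝ) (P₀ P₁ : Measure (Vec d)) (B : Set (Measure ℝ)) : ℝ≥0∞ :=
  sInf { c | ∃ (Ω : Type) (_ : MeasureSpace Ω), IsProbabilityMeasure (volume : Measure Ω) ∧
    ∃ (X₀ X₁ : Ω → Vec d) (M : Ω → ℝ),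
      Measurable X₀ ∧ Measurable X₁ ∧ Measurable M ∧
      (∀ᵐ ω ∂(volume : Measure Ω), 0 ≤ M ω) ∧ Measure.map M volume ∈ B ∧
      (∀ᵐ ω ∂(volume : Measure Ω), ‖X₁ ω - X₀ ω‖ ≤ M ω) ∧
      Measure.map X₀ volume = P₀ ∧ Measure.map X₁ volume = P₁ ∧
      c = ∫⁻ ω in {ω | 0 < M ω}, ENNReal.ofReal (ℓ (M ω) / M ω * ‖X₁ ω - X₀ ω‖) }

/-- `((ξ,φ), M)` is an admissible pair for `V(P₀,P₁;B)`. -/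
def IsVvalAdmissible {d : ℕ} (P₀ P₁ : Measure (Vec d)) (B : Set (Measure ℝ)) (Ω : Type)
    [MeasureSpace Ω] (ξ : Ω → Vec d) (φ : Ω → ℝ → Vec d) (M : Ω → ℝ) : Prop :=
  IsProbabilityMeasure (volume : Measure Ω) ∧
  Measurable ξ ∧ Measurable (Function.uncurry φ) ∧ Measurable M ∧
  (∀ᵐ ω ∂(volume : Measure Ω), 0 ≤ M ω) ∧ Measure.map M volume ∈ B ∧
  (∀ᵐ ω ∂(volume : Measure Ω), eSup01 (φ ω) ≤ ENNReal.ofReal (M ω)) ∧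
  Measure.map ξ volume = P₀ ∧ Measure.map (fun ω => endPt (ξ ω) (φ ω)) volume = P₁

/-- `((ξ,φ), M)` is a minimizer of `V(P₀,P₁;B)`. -/
def IsVvalMin {d : ℕ} (ℓ : ℝ → ℝ) (P₀ P₁ : Measure (Vec d)) (B : Set (Measure ℝ)) (Ω : Type)
    [MeasureSpace Ω] (ξ : Ω → Vec d) (φ : Ω → ℝ → Vec d) (M : Ω → ℝ) : Prop :=
  IsVvalAdmissible P₀ P₁ B Ω ξ φ M ∧
  (∫⁻ ω, ∫⁻ t in Icc (0:ℝ) 1, ENNReal.ofReal (ℓ ‖φ ω t‖)) = Vval ℓ P₀ P₁ B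

/-- `(X₀,X₁,M)` is an admissible triplet in `Π_∞(P₀,P₁;B)`. -/
def IsTVAdmissible {d : ℕ} (P₀ P₁ : Measure (Vec d)) (B : Set (Measure ℝ)) (Ω : Type)
    [MeasureSpace Ω] (X₀ X₁ : Ω → Vec d) (M : Ω → ℝ) : Prop :=
  IsProbabilityMeasure (volume : Measure Ω) ∧ Measurable X₀ ∧ Measurable X₁ ∧ Measurable M ∧
  (∀ᵐ ω ∂(volume : Measure Ω), 0 ≤ M ω) ∧ Measure.map M volume ∈ B ∧
  (∀ᵐ ω ∂(volume : Measure Ω), ‖X₁ ω - X₀ ω‖ ≤ M ω) ∧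
  Measure.map X₀ volume = P₀ ∧ Measure.map X₁ volume = P₁

/-- `(X₀,X₁,M)` is a minimizer of `T^V(P₀,P₁;B)`. -/
def IsTVMin {d : ℕ} (ℓ : ℝ → ℝ) (P₀ P₁ : Measure (Vec d)) (B : Set (Measure ℝ)) (Ω : Type)
    [MeasureSpace Ω] (X₀ X₁ : Ω → Vec d) (M : Ω → ℝ) : Prop :=
  IsTVAdmissible P₀ P₁ B Ω X₀ X₁ M ∧
  (∫⁻ ω in {ω | 0 < M ω}, ENNReal.ofReal (ℓ (M ω) / M ω * ‖X₁ ω - X₀ ω‖)) = TVval ℓ P₀ P₁ B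


/-- the unconstrained value `inf{E[∫₀¹ ℓ(|X'(t)|) dt] : X ∈ 𝒜_∞(P₀,P₁)}`. -/
def VInfPlain {d : ℕ} (ℓ : ℝ → ℝ) (P₀ P₁ : Measure (Vec d)) : ℝ≥0∞ :=
  sInf { c | ∃ (Ω : Type) (_ : MeasureSpace Ω) (ξ : Ω → Vec d) (φ : Ω → ℝ → Vec d),
    IsAdmissible P₀ P₁ Ω ξ φ ∧ c = ∫⁻ ω, ∫⁻ t in Icc (0:ℝ) 1, ENNReal.ofReal (ℓ ‖φ ω t‖) }

/-- the value `V(P₀,P₁) = inf{E[∫₀¹ L(X'(t)) dt] : X ∈ 𝒜(P₀,P₁)}`, over stochastic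
processes with a.s. absolutely continuous (integrable derivative) paths. -/
def Vplain {d : ℕ} (L : Vec d → ℝ) (P₀ P₁ : Measure (Vec d)) : ℝ≥0∞ :=
  sInf { c | ∃ (Ω : Type) (_ : MeasureSpace Ω), IsProbabilityMeasure (volume : Measure Ω) ∧
    ∃ (ξ : Ω → Vec d) (φ : Ω → ℝ → Vec d),
      Measurable ξ ∧ Measurable (Function.uncurry φ) ∧
      (∀ᵐ ω ∂(volume : Measure Ω), IntegrableOn (φ ω) (Icc (0:ℝ) 1)) ∧
      Measure.map ξ volume = P₀ ∧ Measure.map (fun ω => endPt (ξ ω) (φ ω)) volume = P₁ ∧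
      c = ∫⁻ ω, ∫⁻ t in Icc (0:ℝ) 1, ENNReal.ofReal (L (φ ω t)) }

/-- the (topological) support of a Borel measure on `ℝ^d`. -/
def msupport {d : ℕ} (μ : Measure (Vec d)) : Set (Vec d) :=
  {x | ∀ ε : ℝ, 0 < ε → 0 < μ (Metric.ball x ε)}

end

lemma aux_ell (ℓ : ℝ → ℝ)
    (hℓ0 : ℓ 0 = 0)
    (hA1i : ∀ r u : ℝ, 0 < r → r < 1 → 0 < u → r * ℓ u ≤ ℓ (r * u))
    (r u : ℝ) (h0 : 0 ≤ r) (h1 : r ≤ 1) (hu : 0 < u) : r * ℓ u ≤ ℓ (r * u) := by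
  rcases h0.eq_or_lt with h | h
  · subst h; simp [hℓ0]
  · rcases h1.eq_or_lt with h' | h'
    · subst h'; simp
    · exact hA1i r u h h' hu

lemma aux_lower {d : ℕ} (ℓ : ℝ → ℝ)
    (hℓnn : ∀ u : ℝ, 0 ≤ u → 0 ≤ ℓ u) (hℓ0 : ℓ 0 = 0)
    (hA1i : ∀ r u : ℝ, 0 < r → r < 1 → 0 < u → r * ℓ u ≤ ℓ (r * u))
    (N : (ℝ → Vec d) → ℝ) (φ : ℝ → Vec d) (hφ : Measurable φ) (hb : eSup01 φ < ⊤)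
    (m : ℝ) (hm : 0 < m) (hm1 : m ≤ ∫ s in (0:ℝ)..1, ‖φ s‖)
    (hN : N φ = (eSup01 φ).toReal / m) :
    ENNReal.ofReal (ℓ m) ≤ pathCost ℓ N φ := by
  set S := (eSup01 φ).toReal with hS
  have hae : ∀ᵐ t ∂(volume.restrict (Icc (0:ℝ) 1)), ‖φ t‖ ≤ S := by
    have h := ENNReal.ae_le_essSup (μ := volume.restrict (Icc (0:ℝ) 1))
      (fun s => (‖φ s‖₊ : ℝ≥0∞))
    filter_upwards [h] with t ht
    have h2 := ENNReal.toReal_mono hb.ne ht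
    simpa using h2
  have hS0 : 0 ≤ S := ENNReal.toReal_nonneg
  have hint : Integrable (fun t => ‖φ t‖) (volume.restrict (Icc (0:ℝ) 1)) :=
    Integrable.of_bound hφ.norm.aestronglyMeasurable S (by simpa using hae)
  have hII : ∫ s in (0:ℝ)..1, ‖φ s‖ = ∫ s in Icc (0:ℝ) 1, ‖φ s‖ := by
    rw [intervalIntegral.integral_of_le zero_le_one, integral_Icc_eq_integral_Ioc]
  have hSpos : 0 < S := by
    rcases hS0.eq_or_lt with h | h
    · exfalso
      have : ∫ s in Icc (0:ℝ) 1, ‖φ s‖ = 0 := by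
        apply integral_eq_zero_of_ae
        filter_upwards [hae] with t ht
        exact le_antisymm (ht.trans h.symm.le) (norm_nonneg _)
      linarith
    · exact h
  have hℓm := hℓnn m hm.le
  calc ENNReal.ofReal (ℓ m) ≤ ENNReal.ofReal (∫ s in Icc (0:ℝ) 1, ‖φ s‖ * (ℓ m / m)) := by
        apply ENNReal.ofReal_le_ofReal
        rw [integral_mul_const, ← hII]
        calc ℓ m = m * (ℓ m / m) := by field_simp
          _ ≤ _ := by gcongr
    _ = ∫⁻ s in Icc (0:ℝ) 1, ENNReal.ofReal (‖φ s‖ * (ℓ m / m)) := by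
        apply ofReal_integral_eq_lintegral_ofReal (hint.mul_const _)
        exact Eventually.of_forall fun t => by positivity
    _ ≤ _ := by
        apply lintegral_mono_ae
        filter_upwards [hae] with t ht
        apply ENNReal.ofReal_le_ofReal
        rw [hN]
        have h := aux_ell ℓ hℓ0 hA1i (‖φ t‖ / S) m (by positivity)
          ((div_le_one hSpos).2 ht) hm
        have e : ‖φ t‖ / (S / m) = ‖φ t‖ / S * m := by field_simp
        rw [e]
        calc ‖φ t‖ * (ℓ m / m) = S / m * (‖φ t‖ / S * ℓ m) := by field_simp
          _ ≤ _ := by gcongr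

/-- The constant path is at least as good, for either normalisation. -/
lemma aux_le {d : ℕ} (ℓ : ℝ → ℝ) (N N' : (ℝ → Vec d) → ℝ)
    (P₀ P₁ : Measure (Vec d))
    (hN : ∀ φ : ℝ → Vec d, Measurable φ → eSup01 φ < ⊤ →
      ENNReal.ofReal (ℓ ‖∫ s in (0:ℝ)..1, φ s‖) ≤ pathCost ℓ N φ)
    (hN' : ∀ c : Vec d, N' (fun _ => c) = 1) :
    Vtilde ℓ N' P₀ P₁ ≤ Vtilde ℓ N P₀ P₁ := by
  apply le_sInf
  rintro c ⟨Ω, mΩ, ξ, φ, ⟨hp, hξ, hφ, hb, h0, h1⟩, rfl⟩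
  have hI : Measurable fun ω => ∫ s in (0:ℝ)..1, φ ω s := by
    simp_rw [intervalIntegral.integral_of_le zero_le_one]
    exact (StronglyMeasurable.integral_prod_right
      (ν := volume.restrict (Ioc (0:ℝ) 1)) hφ.stronglyMeasurable).measurable
  unfold Vtilde
  refine le_trans (b := ∫⁻ ω, pathCost ℓ N' (fun _ => ∫ s in (0:ℝ)..1, φ ω s))
    (sInf_le ⟨Ω, mΩ, ξ, fun ω _ => ∫ s in (0:ℝ)..1, φ ω s,
    ⟨hp, hξ, hI.comp measurable_fst, ?_, h0, ?_⟩, rfl⟩) ?_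
  · refine Eventually.of_forall fun ω => ?_
    refine lt_of_le_of_lt (essSup_le_of_ae_le (‖∫ s in (0:ℝ)..1, φ ω s‖₊ : ℝ≥0∞) ?_)
      ENNReal.coe_lt_top
    exact Eventually.of_forall fun _ => le_rfl
  · simpa [endPt] using h1
  · apply lintegral_mono_ae
    filter_upwards [hb] with ω hω
    refine le_trans ?_ (hN (φ ω) (hφ.comp measurable_prodMk_left) hω)
    simp [pathCost, hN']

lemma eSup01_const {d : ℕ} (c : Vec d) : (eSup01 (fun _ => c)).toReal = ‖c‖ := by
  unfold eSup01 eSupT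
  rw [essSup_const]
  · simp
  · intro h
    have := congrArg (fun μ => μ univ) h
    simp at this

/-- Theorem 2.2 (i): under (A1,i), (A1,iii) and (A2,i),
`Ṽ₁(P₀,P₁) = Ṽ₂(P₀,P₁)`. -/
theorem statement4 {d : ℕ} (hd : 1 ≤ d) (ℓ : ℝ → ℝ)
    (hℓnn : ∀ u : ℝ, 0 ≤ u → 0 ≤ ℓ u) (hℓ0 : ℓ 0 = 0)
    (hA1i : ∀ r u : ℝ, 0 < r → r < 1 → 0 < u → r * ℓ u ≤ ℓ (r * u))
    (hA1iii : ∀ u : ℝ, 0 < u → 0 < ℓ u)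
    (hA2i : MonotoneOn ℓ (Ici (0:ℝ)))
    (P₀ P₁ : Measure (Vec d)) [IsProbabilityMeasure P₀] [IsProbabilityMeasure P₁] :
    Vtilde ℓ N1 P₀ P₁ = Vtilde ℓ N2 P₀ P₁ := by
  have hc1 : ∀ c : Vec d, N1 (fun _ => c) = 1 := by
    intro c
    have := eSup01_const c
    unfold eSup01 at this
    by_cases h : c = 0
    · simp [N1, N1T, h]
    · simp [N1, N1T, this, h]
  have hc2 : ∀ c : Vec d, N2 (fun _ => c) = 1 := by
    intro c
    have := eSup01_const c
    unfold eSup01 at this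
    by_cases h : c = 0
    · simp [N2, N2T, h]
    · simp [N2, N2T, this, h]
  have hle : ∀ φ : ℝ → Vec d, ‖∫ s in (0:ℝ)..1, φ s‖ ≤ ∫ s in (0:ℝ)..1, ‖φ s‖ := fun φ =>
    intervalIntegral.norm_integral_le_integral_norm zero_le_one
  apply le_antisymm
  · apply aux_le ℓ N2 N1 P₀ P₁ _ hc1
    intro φ hφ hb
    by_cases h : 0 < ∫ s in (0:ℝ)..1, ‖φ s‖
    · refine le_trans (ENNReal.ofReal_le_ofReal ?_)
        (aux_lower ℓ hℓnn hℓ0 hA1i N2 φ hφ hb _ h le_rfl ?_)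
      · exact hA2i (norm_nonneg _) h.le (hle φ)
      · simp [N2, N2T, h, eSup01]
    · have : ‖∫ s in (0:ℝ)..1, φ s‖ = 0 :=
        le_antisymm ((hle φ).trans (not_lt.1 h)) (norm_nonneg _)
      simp [this, hℓ0]
  · apply aux_le ℓ N1 N2 P₀ P₁ _ hc2
    intro φ hφ hb
    by_cases h : (∫ s in (0:ℝ)..1, φ s) = 0
    · simp [h, hℓ0]
    · refine aux_lower ℓ hℓnn hℓ0 hA1i N1 φ hφ hb _ (norm_pos_iff.2 h) (hle φ) ?_
      simp [N1, N1T, h, eSup01]
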